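/- arXiv:1708.00064 — 2 statements merged into one kernel-verified Lean document; each statement's English description precedes it below -/
import Mathlib

section
/- Let G be a generalized 3-sun: a graph consisting of a triangle on vertices v₁, v₂, v₃ together with three pairwise vertex-disjoint nonempty paths P₁, P₂, P₃ (disjoint from the triangle), where for each i one endpoint of P_i is joined by an edge to v_i. Then no matrix A ∈ S(G) has two consecutive multiple eigenvalues; that is, there do not exist eigenvalues λ < μ of A, each of multiplicity at least 2, such that A has no eigenvalue strictly between λ and μ. -/
open Matrix

/-- The geometric multiplicity of `lam` as an eigenvalue of `A`:
`dim ker (A - lam • I)`. -/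
noncomputable def multOf {m : Type*} [Fintype m] [DecidableEq m]
    (A : Matrix m m ℝ) (lam : ℝ) : ℕ :=
  Module.finrank ℝ (LinearMap.ker (A - lam • (1 : Matrix m m ℝ)).mulVecLin)

/-- The Strong Spectral Property. -/
def HasSSP {m : Type*} [Fintype m] [DecidableEq m] (A : Matrix m m ℝ) : Prop :=
  ∀ X : Matrix m m ℝ, X.IsSymm → Matrix.hadamard A X = 0 →
    Matrix.hadamard (1 : Matrix m m ℝ) X = 0 → A * X - X * A = 0 → X = 0

/-- `A ∈ S(G)`: `A` is symmetric and its off-diagonal nonzero pattern is given by `G`. -/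
def InS {m : Type*} [Fintype m] [DecidableEq m]
    (G : SimpleGraph m) (A : Matrix m m ℝ) : Prop :=
  A.IsSymm ∧ ∀ i j, i ≠ j → (A i j ≠ 0 ↔ G.Adj i j)


/-- The generalized 3-sun with path lengths `a`, `b`, `c`: a triangle on the
three vertices `Sum.inl 0, Sum.inl 1, Sum.inl 2`, together with three pairwise
disjoint paths (on `Fin a`, `Fin b`, `Fin c`, consecutive vertices adjacent),
where vertex `0` of each path is joined to the corresponding triangle vertex. -/
def gen3Sun (a b c : ℕ) : SimpleGraph (Fin 3 ⊕ (Fin a ⊕ Fin b ⊕ Fin c)) :=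
  SimpleGraph.fromRel fun u v =>
    match u, v with
    | Sum.inl i, Sum.inl j => i ≠ j
    | Sum.inl i, Sum.inr (Sum.inl p) => i = 0 ∧ p.val = 0
    | Sum.inl i, Sum.inr (Sum.inr (Sum.inl p)) => i = 1 ∧ p.val = 0
    | Sum.inl i, Sum.inr (Sum.inr (Sum.inr p)) => i = 2 ∧ p.val = 0
    | Sum.inr (Sum.inl p), Sum.inr (Sum.inl q) => p.val + 1 = q.val
    | Sum.inr (Sum.inr (Sum.inl p)), Sum.inr (Sum.inr (Sum.inl q)) => p.val + 1 = q.val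
    | Sum.inr (Sum.inr (Sum.inr p)), Sum.inr (Sum.inr (Sum.inr q)) => p.val + 1 = q.val
    | _, _ => False

/-- `G` is a generalized 3-sun: a triangle together with three pairwise disjoint
nonempty paths, one attached to each triangle vertex. -/
def IsGen3Sun {n : ℕ} (G : SimpleGraph (Fin n)) : Prop :=
  ∃ a b c : ℕ, 1 ≤ a ∧ 1 ≤ b ∧ 1 ≤ c ∧ Nonempty (G ≃g gen3Sun a b c)

section ConsecutiveEigenvalues

variable {m : Type*} [Fintype m] [DecidableEq m]

theorem sub_smul_one_mulVec (A : Matrix m m ℝ) (t : ℝ) (x : m → ℝ) :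
    (A - t • (1 : Matrix m m ℝ)) *ᵥ x = A *ᵥ x - t • x := by
  rw [Matrix.sub_mulVec, Matrix.smul_mulVec, Matrix.one_mulVec]

theorem multOf_submatrix {l : Type*} [Fintype l] [DecidableEq l] (A : Matrix m m ℝ)
    (e : l ≃ m) (t : ℝ) : multOf (A.submatrix e e) t = multOf A t := by
  have h : A.submatrix e e - t • (1 : Matrix l l ℝ)
      = (A - t • (1 : Matrix m m ℝ)).submatrix e e := by
    rw [← Matrix.submatrix_one_equiv e]
    rfl
  have h1 := LinearMap.finrank_range_add_finrank_ker
    (A.submatrix e e - t • (1 : Matrix l l ℝ)).mulVecLin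
  have h2 := LinearMap.finrank_range_add_finrank_ker (A - t • (1 : Matrix m m ℝ)).mulVecLin
  have h3 : (A.submatrix e e - t • (1 : Matrix l l ℝ)).rank
      = (A - t • (1 : Matrix m m ℝ)).rank := by
    rw [h, Matrix.rank_submatrix]
  simp only [Matrix.rank, Module.finrank_fintype_fun_eq_card, Fintype.card_congr e] at h1 h2 h3
  unfold multOf
  omega

theorem multOf_ne_zero_of_mulVec_eq {A : Matrix m m ℝ} {t : ℝ} {x : m → ℝ} (hx : x ≠ 0)
    (h : A *ᵥ x = t • x) : multOf A t ≠ 0 := by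
  intro h0
  rw [multOf, Submodule.finrank_eq_zero] at h0
  refine hx ((Submodule.mem_bot ℝ).1 (h0 ▸ ?_))
  rw [LinearMap.mem_ker, Matrix.mulVecLin_apply, sub_smul_one_mulVec, h, sub_self]

/-- A multiple eigenvalue has an eigenvector vanishing at any prescribed coordinate. -/
theorem exists_mulVec_eq_of_two_le_multOf {A : Matrix m m ℝ} {t : ℝ} (h : 2 ≤ multOf A t)
    (i : m) : ∃ x : m → ℝ, x ≠ 0 ∧ A *ᵥ x = t • x ∧ x i = 0 := by
  set K := LinearMap.ker (A - t • (1 : Matrix m m ℝ)).mulVecLin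
  let f : K →ₗ[ℝ] ℝ := (LinearMap.proj i).comp K.subtype
  have hf : LinearMap.ker f ≠ ⊥ := by
    apply LinearMap.ker_ne_bot_of_finrank_lt
    rw [Module.finrank_self]
    exact h
  obtain ⟨x, hx, hx0⟩ := Submodule.exists_mem_ne_zero_of_ne_bot hf
  refine ⟨x, fun h0 => hx0 (Subtype.ext h0), ?_, hx⟩
  have hk := LinearMap.mem_ker.1 x.2
  rw [Matrix.mulVecLin_apply, sub_smul_one_mulVec] at hk
  exact sub_eq_zero.1 hk

/-- If `A` has no eigenvalue in `(lam, mu)` then `(A - lam) (A - mu)` is positive semidefinite. -/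
theorem posSemidef_of_multOf_eq_zero {A : Matrix m m ℝ} (hA : A.IsSymm) {lam mu : ℝ}
    (hlt : lam < mu) (h : ∀ t, lam < t → t < mu → multOf A t = 0) :
    ((A - lam • (1 : Matrix m m ℝ)) * (A - mu • (1 : Matrix m m ℝ))).PosSemidef := by
  have hH : A.IsHermitian := by
    rw [Matrix.IsHermitian, Matrix.conjTranspose_eq_transpose_of_trivial]; exact hA
  set U : Matrix m m ℝ := (hH.eigenvectorUnitary : Matrix m m ℝ)
  set D : Matrix m m ℝ := Matrix.diagonal hH.eigenvalues with hD
  have hUU : U * Uᴴ = 1 := Unitary.mul_star_self_of_mem hH.eigenvectorUnitary.2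
  have hUU' : Uᴴ * U = 1 := Unitary.star_mul_self_of_mem hH.eigenvectorUnitary.2
  have hAD : A = U * D * Uᴴ := by
    have := hH.spectral_theorem
    rw [Unitary.conjStarAlgAut_apply] at this
    exact this
  have hs : ∀ t : ℝ, A - t • (1 : Matrix m m ℝ)
      = U * Matrix.diagonal (fun i => hH.eigenvalues i - t) * Uᴴ := by
    intro t
    have : Matrix.diagonal (fun i => hH.eigenvalues i - t) = D - t • (1 : Matrix m m ℝ) := by
      rw [hD, Matrix.smul_one_eq_diagonal, Matrix.diagonal_sub]
    rw [this, Matrix.mul_sub, Matrix.sub_mul, ← hAD, Matrix.mul_smul, Matrix.mul_one,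
      Matrix.smul_mul, hUU]
  have hM : (A - lam • (1 : Matrix m m ℝ)) * (A - mu • (1 : Matrix m m ℝ))
      = U * Matrix.diagonal (fun i => (hH.eigenvalues i - lam) * (hH.eigenvalues i - mu)) * Uᴴ := by
    rw [hs, hs, ← Matrix.diagonal_mul_diagonal]
    simp only [Matrix.mul_assoc]
    rw [← Matrix.mul_assoc Uᴴ U, hUU', Matrix.one_mul]
  rw [hM]
  refine Matrix.PosSemidef.mul_mul_conjTranspose_same (Matrix.PosSemidef.diagonal fun i => ?_) U
  by_contra hneg
  rw [Pi.zero_apply, not_le, mul_neg_iff] at hneg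
  have hb : lam < hH.eigenvalues i ∧ hH.eigenvalues i < mu → False := fun hi => by
    refine multOf_ne_zero_of_mulVec_eq (x := (hH.eigenvectorBasis i).ofLp) ?_
      (hH.mulVec_eigenvectorBasis i) (h _ hi.1 hi.2)
    intro h0
    exact hH.eigenvectorBasis.orthonormal.ne_zero i (by ext j; exact congrFun h0 j)
  rcases hneg with hi | hi
  · exact hb ⟨by linarith [hi.1], by linarith [hi.2]⟩
  · linarith [hi.1, hi.2]

/-- If `(A - lam) y = (A - mu) z = g`, where `g ≠ 0` satisfies `g ⬝ y = g ⬝ z`, then `A` has an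
eigenvalue strictly between `lam` and `mu`. -/
theorem exists_multOf_ne_zero_of_mulVec_eq {A : Matrix m m ℝ} (hA : A.IsSymm) {lam mu : ℝ}
    (hlt : lam < mu) {g y z : m → ℝ} (hg : g ≠ 0) (hy : A *ᵥ y = lam • y + g)
    (hz : A *ᵥ z = mu • z + g) (hgyz : g ⬝ᵥ y = g ⬝ᵥ z) :
    ∃ t, lam < t ∧ t < mu ∧ multOf A t ≠ 0 := by
  by_contra! h
  have hpsd := posSemidef_of_multOf_eq_zero hA hlt h
  have hne : mu - lam ≠ 0 := sub_ne_zero.2 hlt.ne'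
  have hyz : y ⬝ᵥ z = 0 := by
    have h1 : (A *ᵥ y) ⬝ᵥ z = y ⬝ᵥ (A *ᵥ z) := by
      rw [Matrix.dotProduct_mulVec, ← Matrix.mulVec_transpose, hA.eq]
    rw [hy, hz, add_dotProduct, dotProduct_add, smul_dotProduct, dotProduct_smul,
      dotProduct_comm y g, hgyz, smul_eq_mul, smul_eq_mul] at h1
    exact (mul_eq_zero.1 (show (mu - lam) * (y ⬝ᵥ z) = 0 by linarith)).resolve_left hne
  have hx : ((A - lam • (1 : Matrix m m ℝ)) * (A - mu • (1 : Matrix m m ℝ))) *ᵥ (y - z)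
      = (lam - mu) • g := by
    rw [← Matrix.mulVec_mulVec]
    have h1 : (A - mu • (1 : Matrix m m ℝ)) *ᵥ (y - z) = (lam - mu) • y := by
      rw [sub_smul_one_mulVec, Matrix.mulVec_sub, hy, hz]; module
    rw [h1, Matrix.mulVec_smul, sub_smul_one_mulVec, hy]; module
  have h0 := (hpsd.dotProduct_mulVec_zero_iff (y - z)).1 (by
    rw [hx, star_trivial, dotProduct_smul, sub_dotProduct, dotProduct_comm y, dotProduct_comm z,
      hgyz, sub_self, smul_zero])
  rw [hx, smul_eq_zero] at h0
  exact h0.elim (fun h => hne (by linarith)) hg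

end ConsecutiveEigenvalues

section ZeroForcing

variable {m : Type*} [Fintype m] [DecidableEq m] {G : SimpleGraph m} {B : Matrix m m ℝ}

theorem InS.eq_zero_of_not_adj (hB : InS G B) {u v : m} (huv : u ≠ v) (h : ¬ G.Adj u v) :
    B u v = 0 :=
  by_contra fun h0 => h ((hB.2 u v huv).1 h0)

/-- The colour change rule of zero forcing: if an eigenvector vanishes at `u` and at all neighbours
of `u` except possibly `w`, then it vanishes at `w`. -/
theorem InS.apply_eq_zero_of_adj (hB : InS G B) {t : ℝ} {k : m → ℝ} (hk : B *ᵥ k = t • k)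
    {u w : m} (huw : G.Adj u w) (hu : k u = 0) (h : ∀ v, G.Adj u v → v ≠ w → k v = 0) :
    k w = 0 := by
  have h1 := congrFun hk u
  rw [Pi.smul_apply, hu, smul_zero, Matrix.mulVec, dotProduct, Finset.sum_eq_single w] at h1
  · exact (mul_eq_zero.1 h1).resolve_left ((hB.2 u w huw.ne).2 huw)
  · intro v _ hvw
    by_cases huv : u = v
    · rw [← huv, hu, mul_zero]
    · by_cases hadj : G.Adj u v
      · rw [h v hadj hvw, mul_zero]
      · rw [hB.eq_zero_of_not_adj huv hadj, zero_mul]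
  · simp

/-- If an eigenvector vanishes at the first vertex of a path `p` and at all neighbours of its
non-final vertices outside the path, then it vanishes on the whole path. -/
theorem InS.apply_path_eq_zero (hB : InS G B) {t : ℝ} {k : m → ℝ} (hk : B *ᵥ k = t • k) {l : ℕ}
    (p : Fin l → m) (hp0 : ∀ i : Fin l, i.val = 0 → k (p i) = 0)
    (hadj : ∀ i j : Fin l, i.val + 1 = j.val → G.Adj (p i) (p j))
    (hnb : ∀ i v, i.val + 1 < l → G.Adj (p i) v →
      k v = 0 ∨ ∃ j : Fin l, v = p j ∧ (j.val + 1 = i.val ∨ i.val + 1 = j.val))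
    (i : Fin l) : k (p i) = 0 := by
  obtain ⟨i, hi⟩ := i
  induction i using Nat.strong_induction_on with
  | _ i ih =>
    match i, ih, hi with
    | 0, _, hi => exact hp0 _ rfl
    | i + 1, ih, hi =>
      refine hB.apply_eq_zero_of_adj hk (hadj ⟨i, by omega⟩ _ rfl) (ih i (by omega) _) ?_
      intro v hv hne
      obtain h | ⟨j, rfl, h | h⟩ := hnb _ _ hi hv
      · exact h
      · exact ih j (by simp only at h; omega) j.2
      · exact absurd (congrArg p (Fin.ext h.symm)) hne

end ZeroForcing

section Gen3Sun

variable {a b c : ℕ}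
  {B : Matrix (Fin 3 ⊕ (Fin a ⊕ Fin b ⊕ Fin c)) (Fin 3 ⊕ (Fin a ⊕ Fin b ⊕ Fin c)) ℝ}
  {t : ℝ} {k : Fin 3 ⊕ (Fin a ⊕ Fin b ⊕ Fin c) → ℝ}

/-- An eigenvector on a generalized 3-sun vanishing on the triangle vanishes everywhere. -/
theorem InS.eq_zero_of_triangle (hB : InS (gen3Sun a b c) B) (hk : B *ᵥ k = t • k)
    (h : ∀ i, k (Sum.inl i) = 0) : k = 0 := by
  have h1 : ∀ p : Fin a, k (Sum.inr <| .inl p) = 0 := by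
    refine hB.apply_path_eq_zero hk (fun p => Sum.inr <| .inl p) ?_ ?_ ?_
    · intro p hp
      refine hB.apply_eq_zero_of_adj hk (u := .inl 0) (by simp [gen3Sun, hp]) (h 0) ?_
      rintro (j | q | q | q) hq hne <;> simp_all [gen3Sun, Fin.ext_iff, -Fin.val_eq_zero_iff]
    · intro p q hpq
      simp [gen3Sun, Fin.ext_iff, -Fin.val_eq_zero_iff]
      omega
    · rintro p (j | q | q | q) - hq <;> simp [gen3Sun] at hq
      · exact .inl (h j)
      · exact .inr ⟨q, rfl, by omega⟩
  have h2 : ∀ p : Fin b, k (Sum.inr <| .inr <| .inl p) = 0 := by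
    refine hB.apply_path_eq_zero hk (fun p => Sum.inr <| .inr <| .inl p) ?_ ?_ ?_
    · intro p hp
      refine hB.apply_eq_zero_of_adj hk (u := .inl 1) (by simp [gen3Sun, hp]) (h 1) ?_
      rintro (j | q | q | q) hq hne <;> simp_all [gen3Sun, Fin.ext_iff, -Fin.val_eq_zero_iff]
    · intro p q hpq
      simp [gen3Sun, Fin.ext_iff, -Fin.val_eq_zero_iff]
      omega
    · rintro p (j | q | q | q) - hq <;> simp [gen3Sun] at hq
      · exact .inl (h j)
      · exact .inr ⟨q, rfl, by omega⟩
  have h3 : ∀ p : Fin c, k (Sum.inr <| .inr <| .inr p) = 0 := by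
    refine hB.apply_path_eq_zero hk (fun p => Sum.inr <| .inr <| .inr p) ?_ ?_ ?_
    · intro p hp
      refine hB.apply_eq_zero_of_adj hk (u := .inl 2) (by simp [gen3Sun, hp]) (h 2) ?_
      rintro (j | q | q | q) hq hne <;> simp_all [gen3Sun, Fin.ext_iff, -Fin.val_eq_zero_iff]
    · intro p q hpq
      simp [gen3Sun, Fin.ext_iff, -Fin.val_eq_zero_iff]
      omega
    · rintro p (j | q | q | q) - hq <;> simp [gen3Sun] at hq
      · exact .inl (h j)
      · exact .inr ⟨q, rfl, by omega⟩
  funext u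
  rcases u with j | p | p | p
  exacts [h j, h1 p, h2 p, h3 p]

/-- An eigenvector on a generalized 3-sun vanishing at the leaf of the third path vanishes on that
path and on the triangle vertex it is attached to. -/
theorem InS.eq_zero_of_leaf (hB : InS (gen3Sun a b c) B) (hk : B *ᵥ k = t • k) (hc : 0 < c)
    (h : k (.inr (.inr (.inr ⟨c - 1, by omega⟩))) = 0) :
    (∀ p, k (.inr (.inr (.inr p))) = 0) ∧ k (.inl 2) = 0 := by
  have h1 : ∀ p : Fin c, k (.inr (.inr (.inr p.rev))) = 0 := by
    refine hB.apply_path_eq_zero hk (fun p => Sum.inr <| .inr <| .inr p.rev) ?_ ?_ ?_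
    · intro p hp
      rw [← h]
      congr
      ext
      rw [Fin.val_rev]
      simp only
      omega
    · intro p q hpq
      simp [gen3Sun, Fin.ext_iff, -Fin.val_eq_zero_iff]
      omega
    · rintro p (j | q | q | q) hp hq <;>
        simp [gen3Sun, Fin.ext_iff, -Fin.val_eq_zero_iff] at hq
      · omega
      · exact .inr ⟨q.rev, by simp, by rw [Fin.val_rev]; omega⟩
  have h2 : ∀ p : Fin c, k (.inr (.inr (.inr p))) = 0 := fun p => by simpa using h1 p.rev
  refine ⟨h2, hB.apply_eq_zero_of_adj hk (u := .inr (.inr (.inr ⟨0, hc⟩)))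
    (by simp [gen3Sun]) (h2 _) ?_⟩
  rintro (j | p | p | p) hp hne <;> simp [gen3Sun] at hp hne
  · exact absurd hp hne
  · exact h2 p

/-- For a multiple eigenvalue `t`, the branch at the first triangle vertex carries a vector `y`,
normalized at that vertex, whose residual `B y - t y` does not depend on `t`. -/
theorem InS.exists_branch_vector (hB : InS (gen3Sun a b c) B) (hc : 0 < c) (ht : 2 ≤ multOf B t) :
    ∃ y : Fin 3 ⊕ (Fin a ⊕ Fin b ⊕ Fin c) → ℝ,
      y (.inl 0) = 1 ∧ y (.inl 1) = 0 ∧ y (.inl 2) = 0 ∧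
      B *ᵥ y = t • y + Sum.elim ![B (.inl 0) (.inl 1) * B (.inl 2) (.inl 0) / B (.inl 2) (.inl 1),
        B (.inl 1) (.inl 0), B (.inl 2) (.inl 0)] 0 := by
  obtain ⟨k, hk0, hk, hleaf⟩ := exists_mulVec_eq_of_two_le_multOf ht
    (.inr (.inr (.inr ⟨c - 1, by omega⟩)))
  obtain ⟨hz3, hz2⟩ := hB.eq_zero_of_leaf hk hc hleaf
  have hne : ∀ i j : Fin 3, i ≠ j → B (.inl i) (.inl j) ≠ 0 := fun i j hij =>
    (hB.2 _ _ (by simpa using hij)).2 (by simp [gen3Sun, hij])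
  have hna : ∀ u v, u ≠ v → ¬ (gen3Sun a b c).Adj u v → B u v = 0 :=
    fun _ _ => hB.eq_zero_of_not_adj
  have hrow : ∀ x : Fin 3 ⊕ (Fin a ⊕ Fin b ⊕ Fin c) → ℝ, ∀ u, (B *ᵥ x) u =
      B u (.inl 0) * x (.inl 0) + B u (.inl 1) * x (.inl 1) + B u (.inl 2) * x (.inl 2) +
      (∑ p, B u (.inr (.inl p)) * x (.inr (.inl p)) +
      (∑ p, B u (.inr (.inr (.inl p))) * x (.inr (.inr (.inl p))) +
        ∑ p, B u (.inr (.inr (.inr p))) * x (.inr (.inr (.inr p))))) := by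
    intro x u
    simp only [Matrix.mulVec, dotProduct, Fintype.sum_sum_type, Fin.sum_univ_three]
  have hz1 : B (.inl 2) (.inl 0) * k (.inl 0) + B (.inl 2) (.inl 1) * k (.inl 1) = 0 := by
    have h := congrFun hk (.inl 2)
    rw [hrow] at h
    simpa [hz2, hz3, hna (.inl 2) (.inr (.inl _)) (by simp) (by simp [gen3Sun]),
      hna (.inl 2) (.inr (.inr (.inl _))) (by simp) (by simp [gen3Sun])] using h
  have hk1 : k (.inl 0) ≠ 0 := by
    intro h
    rw [h, mul_zero, zero_add] at hz1
    have h' := (mul_eq_zero.1 hz1).resolve_left (hne 2 1 (by decide))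
    exact hk0 (hB.eq_zero_of_triangle hk (by intro i; fin_cases i <;> assumption))
  set s := (k (.inl 0))⁻¹
  have hks : k (.inl 0) * s = 1 := mul_inv_cancel₀ hk1
  refine ⟨Sum.elim ![1, 0, 0] (Sum.elim (fun p => k (.inr (.inl p)) * s) 0), by simp, by simp,
    by simp, ?_⟩
  funext u
  have h := congrArg (· * s) (congrFun hk u)
  simp only [hrow, add_mul, Finset.sum_mul] at h
  rw [hrow]
  rcases u with j | p | p | p
  · fin_cases j
    · simp [hz2, hz3, hna (.inl 0) (.inr (.inr (.inl _))) (by simp) (by simp [gen3Sun]),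
        mul_assoc, hks] at h ⊢
      have := hne 2 1 (by decide)
      field_simp
      simp only [mul_assoc] at h ⊢
      linear_combination B (.inl 2) (.inl 1) * h - B (.inl 0) (.inl 1) * s * hz1
        + B (.inl 0) (.inl 1) * B (.inl 2) (.inl 0) * hks
    · simp [hna (.inl 1) (.inr (.inl _)) (by simp) (by simp [gen3Sun])]
    · simp [hna (.inl 2) (.inr (.inl _)) (by simp) (by simp [gen3Sun])]
  · simpa [mul_assoc, hks, hz2, hz3, hna (.inr (.inl p)) (.inl 1) (by simp) (by simp [gen3Sun]),
      hna (.inr (.inl p)) (.inr (.inr (.inl _))) (by simp) (by simp [gen3Sun])] using h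
  · simp [hna (.inr (.inr (.inl p))) (.inl 0) (by simp) (by simp [gen3Sun]),
      hna (.inr (.inr (.inl p))) (.inr (.inl _)) (by simp) (by simp [gen3Sun])]
  · simp [hna (.inr (.inr (.inr p))) (.inl 0) (by simp) (by simp [gen3Sun]),
      hna (.inr (.inr (.inr p))) (.inr (.inl _)) (by simp) (by simp [gen3Sun])]

end Gen3Sun

/-- A generalized 3-sun does not allow a matrix with two consecutive multiple
eigenvalues. -/
theorem gen3Sun_no_consecutive_multiple_eigenvalues {n : ℕ}
    (G : SimpleGraph (Fin n)) (hG : IsGen3Sun G)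
    (A : Matrix (Fin n) (Fin n) ℝ) (hA : InS G A) :
    ¬ ∃ lam mu : ℝ, lam < mu ∧ 2 ≤ multOf A lam ∧ 2 ≤ multOf A mu ∧
        ∀ t, lam < t → t < mu → multOf A t = 0 := by
  rintro ⟨lam, mu, hlt, hlam, hmu, h⟩
  obtain ⟨a, b, c, -, -, hc, ⟨e⟩⟩ := hG
  let f := e.symm.toEquiv
  have hB : InS (gen3Sun a b c) (A.submatrix f f) :=
    ⟨hA.1.submatrix f, fun i j hij =>
      (hA.2 (f i) (f j) (f.injective.ne hij)).trans e.symm.map_adj_iff⟩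
  simp only [← multOf_submatrix A f] at hlam hmu h
  obtain ⟨y, hy0, hy1, hy2, hy⟩ := hB.exists_branch_vector hc hlam
  obtain ⟨z, hz0, hz1, hz2, hz⟩ := hB.exists_branch_vector hc hmu
  obtain ⟨t, ht1, ht2, ht⟩ := exists_multOf_ne_zero_of_mulVec_eq hB.1 hlt
    (fun h0 => (hB.2 (.inl 1) (.inl 0) (by simp)).2 (by simp [gen3Sun])
      (congrFun h0 (.inl 1))) hy hz (by
      simp [dotProduct, Fin.sum_univ_three, hy0, hy1, hy2, hz0, hz1, hz2])
  exact ht (h t ht1 ht2)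
end

section
/- (Decontraction Lemma for SSP) Let G be a graph on vertices {1,…,n}, let A ∈ S(G) have the Strong Spectral Property, and let N_G(n) = α ⊔ β be a partition of the neighborhood of vertex n in G. Let H be the graph on vertices {1,…,n+1} whose edges are: all edges of G not incident to n, the edges {n, j} for j ∈ α, the edges {n+1, j} for j ∈ β, and the edge {n, n+1} (so that contracting the edge {n, n+1} of H, whose endpoints have disjoint neighborhoods, yields G). Then there exists λ₀ ∈ ℝ such that for every λ ≥ λ₀ there is a matrix A' ∈ S(H) with the Strong Spectral Property whose spectrum (as a multiset) equals the spectrum of A together with the additional simple eigenvalue λ. -/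
open Matrix

/-- The graph `H` on `{0, …, n+1}` obtained from `G` (on `{0, …, n}`) by splitting
the vertex `n` (the last vertex of `G`) into two adjacent vertices `n` and `n+1`:
the edges of `G` not incident to `n` are kept, vertex `n` is joined to the
neighbors in `α`, the new vertex `n+1` is joined to the neighbors in `β`, and
`n` and `n+1` are joined; contracting the edge `{n, n+1}` of `H` gives back `G`. -/
def decontract {n : ℕ} (G : SimpleGraph (Fin (n + 1))) (α β : Set (Fin (n + 1))) :
    SimpleGraph (Fin (n + 2)) :=
  SimpleGraph.fromRel fun u w =>
    (∃ i j : Fin (n + 1), u = i.castSucc ∧ w = j.castSucc ∧ G.Adj i j ∧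
        i ≠ Fin.last n ∧ j ≠ Fin.last n) ∨
    (∃ j : Fin (n + 1), j ∈ α ∧ u = (Fin.last n).castSucc ∧ w = j.castSucc) ∨
    (∃ j : Fin (n + 1), j ∈ β ∧ u = Fin.last (n + 1) ∧ w = j.castSucc) ∨
    (u = (Fin.last n).castSucc ∧ w = Fin.last (n + 1))

open Filter Topology in
/-- If `F 0` vanishes at `e₀` and its partial derivative there is onto, then the zero persists, close
to `(0, e₀)`, for all small values of the scalar parameter. -/
theorem eventually_exists_zero_of_surjective_partial {E Y : Type*}
    [NormedAddCommGroup E] [NormedSpace ℝ E] [CompleteSpace E]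
    [NormedAddCommGroup Y] [NormedSpace ℝ Y] [CompleteSpace Y]
    {F : ℝ × E → Y} (hF : ContDiff ℝ 1 F) {e₀ : E} (h₀ : F (0, e₀) = 0)
    {L : E → Y} (hL : ∀ v, HasDerivAt (fun t : ℝ => F (0, e₀ + t • v)) (L v) 0)
    (hsurj : Function.Surjective L) {P : ℝ × E → Prop} (hP : ∀ᶠ p in 𝓝 (0, e₀), P p) :
    ∀ᶠ ε in 𝓝 (0 : ℝ), ∃ e, F (ε, e) = 0 ∧ P (ε, e) := by
  have hF' : HasStrictFDerivAt F (fderiv ℝ F (0, e₀)) (0, e₀) :=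
    hF.contDiffAt.hasStrictFDerivAt one_ne_zero
  set D := fderiv ℝ F (0, e₀)
  have hDL : ∀ v, D (0, v) = L v := by
    intro v
    have hline : HasDerivAt (fun t : ℝ => ((0 : ℝ), e₀ + t • v)) ((0 : ℝ), v) 0 := by
      refine (hasDerivAt_const _ _).prodMk ?_
      simpa using ((hasDerivAt_id (0 : ℝ)).smul_const v).const_add e₀
    have hF0 : HasFDerivAt F D ((0 : ℝ), e₀ + (0 : ℝ) • v) := by
      simpa using hF'.hasFDerivAt
    exact (hF0.comp_hasDerivAt (0 : ℝ) hline).unique (hL v)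
  have hstrict : HasStrictFDerivAt (fun p : ℝ × E => (p.1, F p))
      ((ContinuousLinearMap.fst ℝ ℝ E).prod D) (0, e₀) :=
    hasStrictFDerivAt_fst.prodMk hF'
  have honto : ((ContinuousLinearMap.fst ℝ ℝ E).prod D).range = ⊤ := by
    refine LinearMap.range_eq_top.2 ?_
    rintro ⟨t, y⟩
    obtain ⟨v, hv⟩ := hsurj (y - D (t, 0))
    refine ⟨(t, v), Prod.ext rfl ?_⟩
    have : ((t, v) : ℝ × E) = (t, 0) + (0, v) := by simp
    change D (t, v) = y
    rw [this, map_add, hDL, hv]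
    abel
  have hmap := hstrict.map_nhds_eq_of_surj honto
  have hev : ∀ᶠ q in 𝓝 ((0 : ℝ), (0 : Y)), ∃ p, P p ∧ (p.1, F p) = q := by
    rw [h₀] at hmap
    rw [← hmap, eventually_map]
    filter_upwards [hP] with p hp using ⟨p, hp, rfl⟩
  have hcont : Tendsto (fun ε : ℝ => (ε, (0 : Y))) (𝓝 0) (𝓝 (0, 0)) :=
    (continuous_id.prodMk continuous_const).tendsto 0
  filter_upwards [hcont.eventually hev] with ε hε
  obtain ⟨⟨ε', e⟩, hp, hq⟩ := hε
  obtain ⟨rfl, hz⟩ := Prod.ext_iff.1 hq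
  exact ⟨e, hz, hp⟩

open Filter Topology in
/-- Injectivity of a linear map on a subspace persists under small perturbations. -/
theorem eventually_kernel_trivial {P E Y : Type*} [TopologicalSpace P]
    [NormedAddCommGroup E] [NormedSpace ℝ E] [FiniteDimensional ℝ E]
    [AddCommGroup Y] [Module ℝ Y] [TopologicalSpace Y] [T1Space Y] (V : Submodule ℝ E)
    {f : P → E → Y} (hf : Continuous fun q : P × E => f q.1 q.2)
    (hsmul : ∀ p (r : ℝ) x, f p (r • x) = r • f p x) {p₀ : P}
    (h₀ : ∀ x ∈ V, f p₀ x = 0 → x = 0) :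
    ∀ᶠ p in 𝓝 p₀, ∀ x ∈ V, f p x = 0 → x = 0 := by
  have hK : IsCompact (Metric.sphere (0 : E) 1 ∩ (V : Set E)) :=
    (haveI := FiniteDimensional.proper_real E; isCompact_sphere (0 : E) 1).inter_right
      V.closed_of_finiteDimensional
  have hne : ∀ x ∈ Metric.sphere (0 : E) 1 ∩ (V : Set E),
      ∀ᶠ q : P × E in 𝓝 (p₀, x), f q.1 q.2 ≠ 0 := by
    rintro x ⟨hx, hxV⟩
    refine hf.continuousAt.eventually_ne fun h => ?_
    rw [h₀ x hxV h] at hx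
    simp at hx
  filter_upwards [hK.eventually_forall_of_forall_eventually (P := fun p x => f p x ≠ 0) hne] with p hp x hxV hx
  by_contra hx0
  refine hp (‖x‖⁻¹ • x) ⟨?_, V.smul_mem _ hxV⟩ ?_
  · simp [norm_smul, hx0]
  · rw [hsmul, hx, smul_zero]

section Conjugation

open NormedSpace

theorem hasDerivAt_exp_conj {R : Type*} [NormedRing R] [NormedAlgebra ℝ R] [CompleteSpace R]
    (φ : R →L[ℝ] ℝ) (a κ : R) :
    HasDerivAt (fun t : ℝ => φ (exp (-(t • κ)) * a * exp (t • κ))) (φ (a * κ - κ * a)) 0 := by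
  have h₁ : HasDerivAt (fun t : ℝ => exp (-(t • κ))) (-κ) 0 := by
    simpa using hasDerivAt_exp_smul_const (𝕂 := ℝ) (-κ) (0 : ℝ)
  have h₂ : HasDerivAt (fun t : ℝ => exp (t • κ)) κ 0 := by
    simpa using hasDerivAt_exp_smul_const (𝕂 := ℝ) κ (0 : ℝ)
  have e : a * κ - κ * a = -κ * a * exp ((0 : ℝ) • κ) + exp (-((0 : ℝ) • κ)) * a * κ := by
    simp [sub_eq_neg_add]
  rw [e]
  exact φ.hasFDerivAt.comp_hasDerivAt (0 : ℝ) ((h₁.mul_const a).mul h₂)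

variable {m : Type*} [Fintype m] [DecidableEq m]

/-- The conjugate of `A` by the matrix exponential of `κ`. -/
noncomputable def expConj (A κ : Matrix m m ℝ) : Matrix m m ℝ :=
  exp (-κ) * A * exp κ

theorem expConj_zero (A : Matrix m m ℝ) : expConj A 0 = A := by
  simp [expConj]

theorem exp_neg_mul_exp (κ : Matrix m m ℝ) : exp (-κ) * exp κ = 1 := by
  rw [← Matrix.exp_add_of_commute _ _ (Commute.neg_left (Commute.refl κ)), neg_add_cancel,
    exp_zero]

theorem expConj_isSymm {A κ : Matrix m m ℝ} (hA : A.IsSymm) (hκ : κᵀ = -κ) :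
    (expConj A κ).IsSymm := by
  have h : (exp κ)ᵀ = exp (-κ) := by rw [← Matrix.exp_transpose, hκ]
  have h' : (exp (-κ))ᵀ = exp κ := by rw [← h, transpose_transpose]
  rw [Matrix.IsSymm, expConj, transpose_mul, transpose_mul, h, h', hA.eq, mul_assoc]

open scoped Matrix.Norms.Operator in
theorem contDiff_expConj_apply {E : Type*} [NormedAddCommGroup E] [NormedSpace ℝ E]
    [FiniteDimensional ℝ E] (A : Matrix m m ℝ) (K : E →ₗ[ℝ] Matrix m m ℝ) (i j : m) :
    ContDiff ℝ 1 fun x => expConj A (K x) i j := by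
  have hK : ContDiff ℝ 1 K := K.toContinuousLinearMap.contDiff
  have hexp : ContDiff ℝ 1 (exp : Matrix m m ℝ → Matrix m m ℝ) :=
    contDiff_iff_contDiffAt.2 fun x => (exp_analytic (𝕂 := ℝ) x).contDiffAt
  have hc : ContDiff ℝ 1 fun x => expConj A (K x) :=
    ((hexp.comp hK.neg).mul contDiff_const).mul (hexp.comp hK)
  exact (Matrix.entryLinearMap ℝ ℝ i j).toContinuousLinearMap.contDiff.comp hc

open scoped Matrix.Norms.Operator in
theorem hasDerivAt_expConj_apply (A κ : Matrix m m ℝ) (i j : m) :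
    HasDerivAt (fun t : ℝ => expConj A (t • κ) i j) ((A * κ - κ * A) i j) 0 :=
  hasDerivAt_exp_conj (Matrix.entryLinearMap ℝ ℝ i j).toContinuousLinearMap A κ

end Conjugation

section NonedgeSpace

variable {m : Type*}

/-- The symmetric matrices that vanish on the diagonal and on the edges of `G`. -/
def nonedgeSpace (G : SimpleGraph m) : Submodule ℝ (m → m → ℝ) where
  carrier := {X | ∀ i j, X i j = X j i ∧ (G.Adj i j ∨ i = j → X i j = 0)}
  add_mem' {X Y} hX hY i j := by
    refine ⟨?_, fun h => ?_⟩
    · simp [(hX i j).1, (hY i j).1]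
    · simp [(hX i j).2 h, (hY i j).2 h]
  zero_mem' i j := by simp
  smul_mem' r X hX i j := by
    refine ⟨?_, fun h => ?_⟩
    · simp [(hX i j).1]
    · simp [(hX i j).2 h]

open Classical in
/-- Twice the orthogonal projection onto `nonedgeSpace G`, on symmetric matrices. -/
noncomputable def nonedgeProj (G : SimpleGraph m) : Matrix m m ℝ →ₗ[ℝ] nonedgeSpace G where
  toFun X := ⟨fun i j => if G.Adj i j ∨ i = j then 0 else X i j + X j i, fun i j => by
    refine ⟨?_, fun h => if_pos h⟩
    simp only [G.adj_comm i j, eq_comm (a := i), add_comm (X i j)]⟩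
  map_add' X Y := by
    ext i j
    simp only [Submodule.coe_add, Pi.add_apply, Matrix.add_apply]
    split_ifs <;> ring
  map_smul' r X := by
    ext i j
    simp only [Submodule.coe_smul, Pi.smul_apply, Matrix.smul_apply, smul_eq_mul, RingHom.id_apply]
    split_ifs <;> ring

theorem nonedgeProj_apply_of_not_adj {G : SimpleGraph m} (X : Matrix m m ℝ) {i j : m}
    (hij : i ≠ j) (h : ¬ G.Adj i j) : (nonedgeProj G X).1 i j = X i j + X j i :=
  if_neg (by tauto)

variable [Fintype m]

theorem hasSSP_iff [DecidableEq m] {G : SimpleGraph m} {A : Matrix m m ℝ} (hA : InS G A) :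
    HasSSP A ↔ ∀ X ∈ nonedgeSpace G, A * of X = of X * A → X = 0 := by
  constructor
  · intro h X hX hc
    refine h (of X) ?_ ?_ ?_ (sub_eq_zero.2 hc)
    · ext i j
      exact (hX j i).1
    · ext i j
      by_cases hij : i = j
      · simp [(hX i j).2 (Or.inr hij)]
      · by_cases hG : G.Adj i j
        · simp [(hX i j).2 (Or.inl hG)]
        · have : A i j = 0 := not_not.1 (mt (hA.2 i j hij).1 hG)
          simp [this]
    · ext i j
      by_cases hij : i = j
      · simp [(hX i j).2 (Or.inr hij)]
      · simp [hij]
  · intro h X hX hAX hI hc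
    refine h X (fun i j => ⟨hX.apply j i, ?_⟩) (sub_eq_zero.1 hc)
    by_cases hij : i = j
    · intro _
      simpa [hij] using congrFun (congrFun hI i) j
    · rintro (hG | h')
      · have := congrFun (congrFun hAX i) j
        simpa [(hA.2 i j hij).2 hG] using this
      · exact absurd h' hij

/-- The commutator `X A - A X`, as a linear map on `nonedgeSpace G`. -/
noncomputable def nonedgeCommutator (G : SimpleGraph m) (A : Matrix m m ℝ) :
    nonedgeSpace G →ₗ[ℝ] Matrix m m ℝ where
  toFun X := of X.1 * A - A * of X.1
  map_add' X Y := by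
    rw [Submodule.coe_add, ← of_add_of, add_mul, mul_add]
    abel
  map_smul' r X := by
    rw [Submodule.coe_smul, ← smul_of, Matrix.smul_mul, Matrix.mul_smul, smul_sub, RingHom.id_apply]

theorem nonedgeCommutator_transpose {G : SimpleGraph m} {A : Matrix m m ℝ} (hA : A.IsSymm)
    (X : nonedgeSpace G) : (nonedgeCommutator G A X)ᵀ = -nonedgeCommutator G A X := by
  have hX : (of X.1)ᵀ = of X.1 := by
    ext i j
    exact (X.2 j i).1
  simp only [nonedgeCommutator, LinearMap.coe_mk, AddHom.coe_mk, transpose_sub, transpose_mul, hX,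
    hA.eq, neg_sub]

theorem sum_mul_nonedgeProj {G : SimpleGraph m} (X : nonedgeSpace G) {Y : Matrix m m ℝ}
    (hY : Y.IsSymm) :
    ∑ i, ∑ j, X.1 i j * (nonedgeProj G Y).1 i j = 2 * (of X.1 * Y).trace := by
  simp only [trace, diag_apply, mul_apply, Finset.mul_sum, of_apply]
  refine Finset.sum_congr rfl fun i _ => Finset.sum_congr rfl fun j _ => ?_
  by_cases h : G.Adj i j ∨ i = j
  · simp [(X.2 i j).2 h]
  · rw [nonedgeProj_apply_of_not_adj _ (by tauto) (by tauto), hY.apply i j]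
    ring

theorem nonedgeProj_commutator_surjective [DecidableEq m] {G : SimpleGraph m} {A : Matrix m m ℝ}
    (hA : InS G A) (hssp : HasSSP A) :
    Function.Surjective fun X : nonedgeSpace G =>
      nonedgeProj G (A * nonedgeCommutator G A X - nonedgeCommutator G A X * A) := by
  let L : nonedgeSpace G →ₗ[ℝ] nonedgeSpace G :=
    nonedgeProj G ∘ₗ (LinearMap.mulLeft ℝ A - LinearMap.mulRight ℝ A) ∘ₗ nonedgeCommutator G A
  suffices Function.Injective L from LinearMap.injective_iff_surjective.1 this
  refine (injective_iff_map_eq_zero L).2 fun X hX => ?_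
  set κ := nonedgeCommutator G A X with hκ
  have hκT : κᵀ = -κ := nonedgeCommutator_transpose hA.1 X
  have hL : nonedgeProj G (A * κ - κ * A) = 0 := hX
  have hsymm : (A * κ - κ * A).IsSymm := by
    rw [IsSymm, transpose_sub, transpose_mul, transpose_mul, hκT, hA.1.eq]
    simp
    abel
  have htr := sum_mul_nonedgeProj X hsymm
  rw [hL] at htr
  have hκ0 : κ = 0 := by
    refine trace_conjTranspose_mul_self_eq_zero_iff.1 ?_
    rw [conjTranspose_eq_transpose_of_trivial, hκT]
    have h1 : (of X.1 * (A * κ - κ * A)).trace = 0 := by simpa using htr.symm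
    have h2 : (of X.1 * (A * κ - κ * A)).trace = (κ * κ).trace := by
      conv_rhs => rw [hκ]
      change _ = ((of X.1 * A - A * of X.1) * κ).trace
      rw [mul_sub, sub_mul, trace_sub, trace_sub, mul_assoc, mul_assoc,
        trace_mul_comm A (of X.1 * κ), mul_assoc]
    rw [neg_mul, trace_neg, ← h2, h1, neg_zero]
  have h0 : of X.1 * A - A * of X.1 = 0 := hκ0
  exact Subtype.ext ((hasSSP_iff hA).1 hssp X.1 X.2 (sub_eq_zero.1 h0).symm)

end NonedgeSpace

section Bordered

variable {m : Type*}

/-- The direct sum of `C` and the `1 × 1` matrix `μ`. -/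
def bordered (C : Matrix m m ℝ) (μ : ℝ) : Matrix (Option m) (Option m) ℝ :=
  of fun a b => a.elim (b.elim μ fun _ => 0) fun i => b.elim 0 fun j => C i j

@[simp] theorem bordered_some_some (C : Matrix m m ℝ) (μ : ℝ) (i j : m) :
    bordered C μ (some i) (some j) = C i j := rfl

@[simp] theorem bordered_some_none (C : Matrix m m ℝ) (μ : ℝ) (i : m) :
    bordered C μ (some i) none = 0 := rfl

@[simp] theorem bordered_none_some (C : Matrix m m ℝ) (μ : ℝ) (j : m) :
    bordered C μ none (some j) = 0 := rfl

@[simp] theorem bordered_none_none (C : Matrix m m ℝ) (μ : ℝ) :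
    bordered C μ none none = μ := rfl

theorem bordered_isSymm {C : Matrix m m ℝ} (hC : C.IsSymm) (μ : ℝ) : (bordered C μ).IsSymm := by
  ext a b
  cases a <;> cases b <;> simp [hC.apply]

end Bordered

section Multiplicity

variable {m : Type*} [Fintype m]

theorem finrank_ker_bordered (C : Matrix m m ℝ) (μ : ℝ) :
    Module.finrank ℝ (LinearMap.ker (bordered C μ).mulVecLin) =
      Module.finrank ℝ (LinearMap.ker C.mulVecLin) + if μ = 0 then 1 else 0 := by
  have hker : ∀ x : Option m → ℝ, x ∈ LinearMap.ker (bordered C μ).mulVecLin ↔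
      (fun i => x (some i)) ∈ LinearMap.ker C.mulVecLin ∧
        x none ∈ LinearMap.ker (LinearMap.mulLeft ℝ μ) := by
    intro x
    simp only [LinearMap.mem_ker, mulVecLin_apply, LinearMap.mulLeft_apply, funext_iff,
      Option.forall, mulVec, dotProduct, Fintype.sum_option, bordered_none_none,
      bordered_none_some, bordered_some_none, bordered_some_some, Pi.zero_apply, zero_mul,
      Finset.sum_const_zero, add_zero, zero_add]
    exact and_comm
  let e : LinearMap.ker (bordered C μ).mulVecLin ≃ₗ[ℝ]
      LinearMap.ker C.mulVecLin × LinearMap.ker (LinearMap.mulLeft ℝ μ) :=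
    { toFun := fun x => (⟨_, ((hker x.1).1 x.2).1⟩, ⟨_, ((hker x.1).1 x.2).2⟩)
      invFun := fun p => ⟨fun a => a.elim p.2.1 p.1.1, (hker _).2 ⟨p.1.2, p.2.2⟩⟩
      map_add' := fun _ _ => rfl
      map_smul' := fun _ _ => rfl
      left_inv := fun x => by
        ext a
        cases a <;> rfl
      right_inv := fun _ => rfl }
  rw [e.finrank_eq, Module.finrank_prod]
  congr 1
  split_ifs with h
  · have : LinearMap.ker (LinearMap.mulLeft ℝ μ) = ⊤ := by
      ext x
      simp [h]
    rw [this, finrank_top, Module.finrank_self]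
  · have : LinearMap.ker (LinearMap.mulLeft ℝ μ) = ⊥ := by
      ext x
      simp [h]
    rw [this, finrank_bot]

variable [DecidableEq m]

theorem multOf_eq_card_sub_rank (A : Matrix m m ℝ) (t : ℝ) :
    multOf A t = Fintype.card m - (A - t • (1 : Matrix m m ℝ)).rank := by
  have := LinearMap.finrank_range_add_finrank_ker (A - t • (1 : Matrix m m ℝ)).mulVecLin
  rw [Module.finrank_fintype_fun_eq_card] at this
  rw [multOf, rank]
  omega

theorem multOf_conj {P Q : Matrix m m ℝ} (hPQ : P * Q = 1) (A : Matrix m m ℝ) (t : ℝ) :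
    multOf (P * A * Q) t = multOf A t := by
  have hP : IsUnit P.det := by
    refine IsUnit.of_mul_eq_one Q.det ?_
    rw [← det_mul, hPQ, det_one]
  have hQ : IsUnit Q.det := by
    refine IsUnit.of_mul_eq_one P.det ?_
    rw [mul_comm, ← det_mul, hPQ, det_one]
  have h : P * A * Q - t • (1 : Matrix m m ℝ) = P * (A - t • (1 : Matrix m m ℝ)) * Q := by
    rw [mul_sub, sub_mul, Matrix.mul_smul, Matrix.smul_mul, mul_one, hPQ]
  rw [multOf_eq_card_sub_rank, multOf_eq_card_sub_rank, h,
    rank_mul_eq_left_of_isUnit_det Q _ hQ, rank_mul_eq_right_of_isUnit_det P _ hP]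

theorem multOf_submatrix_equiv {l : Type*} [Fintype l] [DecidableEq l] (e : l ≃ m)
    (A : Matrix m m ℝ) (t : ℝ) : multOf (A.submatrix e e) t = multOf A t := by
  have h : A.submatrix e e - t • (1 : Matrix l l ℝ) =
      (A - t • (1 : Matrix m m ℝ)).submatrix e e := by
    ext i j
    simp [one_apply]
  rw [multOf_eq_card_sub_rank, multOf_eq_card_sub_rank, h, rank_submatrix, Fintype.card_congr e]

theorem eventually_multOf_eq_zero (A : Matrix m m ℝ) :
    ∀ᶠ t in Filter.atTop, multOf A t = 0 := by
  filter_upwards [Polynomial.eventually_atTop_not_isRoot A.charpoly A.charpoly_monic.ne_zero] with t ht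
  rw [Polynomial.IsRoot, eval_charpoly] at ht
  have hu : IsUnit (A - t • (1 : Matrix m m ℝ)) := by
    rw [isUnit_iff_isUnit_det, isUnit_iff_ne_zero]
    intro h0
    apply ht
    rw [scalar_apply, ← smul_one_eq_diagonal, ← neg_sub, det_neg, h0, mul_zero]
  rw [multOf_eq_card_sub_rank, rank_of_isUnit _ hu, Nat.sub_self]

theorem multOf_bordered (C : Matrix m m ℝ) (μ t : ℝ) :
    multOf (bordered C μ) t = multOf C t + if t = μ then 1 else 0 := by
  have h : bordered C μ - t • (1 : Matrix (Option m) (Option m) ℝ) =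
      bordered (C - t • (1 : Matrix m m ℝ)) (μ - t) := by
    ext a b
    cases a <;> cases b <;> simp [one_apply]
  rw [multOf, h, finrank_ker_bordered, multOf]
  simp only [sub_eq_zero, eq_comm]

end Multiplicity

section Reflections

variable {m : Type*} [DecidableEq m]

/-- The symmetric orthogonal matrix that acts on the coordinates `some w` and `none` as
`(√2)⁻¹ * !![1, 1; 1, -1]` and fixes the other ones. -/
noncomputable def mixer (w : m) : Matrix (Option m) (Option m) ℝ :=
  of fun a b => a.elim (b.elim (-(√2)⁻¹) fun j => if j = w then (√2)⁻¹ else 0) fun i =>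
    b.elim (if i = w then (√2)⁻¹ else 0) fun j =>
      if i = j then (if i = w then (√2)⁻¹ else 1) else 0

theorem inv_sqrt_two_mul_self : (√2)⁻¹ * (√2)⁻¹ = (1 / 2 : ℝ) := by
  rw [← mul_inv, Real.mul_self_sqrt zero_le_two, one_div]

theorem mixer_isSymm (w : m) : (mixer w).IsSymm := by
  ext a b
  cases a <;> cases b
  · rfl
  · rfl
  · rfl
  · rename_i i j
    by_cases h : i = j
    · simp [mixer, h]
    · simp [mixer, h, Ne.symm h]

variable [Fintype m]

/-- The orthogonal reflection in the hyperplane orthogonal to `z`. -/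
noncomputable def reflectionMatrix (z : m → ℝ) : Matrix m m ℝ :=
  1 - (2 / (z ⬝ᵥ z)) • vecMulVec z z

theorem reflectionMatrix_isSymm (z : m → ℝ) : (reflectionMatrix z).IsSymm := by
  rw [IsSymm, reflectionMatrix, transpose_sub, transpose_smul, transpose_one, transpose_vecMulVec]

theorem reflectionMatrix_mul_self {z : m → ℝ} (hz : z ⬝ᵥ z ≠ 0) :
    reflectionMatrix z * reflectionMatrix z = 1 := by
  have h : vecMulVec z z * vecMulVec z z = (z ⬝ᵥ z) • vecMulVec z z := by
    ext i j
    simp only [mul_apply, vecMulVec_apply, Matrix.smul_apply, smul_eq_mul, dotProduct,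
      Finset.sum_mul]
    exact Finset.sum_congr rfl fun k _ => by ring
  rw [reflectionMatrix, sub_mul, mul_sub, mul_sub, one_mul, mul_one, one_mul, Matrix.smul_mul,
    Matrix.mul_smul, h, smul_smul, smul_smul, sub_sub, ← sub_smul, ← add_smul]
  have : 2 / z ⬝ᵥ z + (2 / z ⬝ᵥ z - 2 / z ⬝ᵥ z * (2 / z ⬝ᵥ z) * z ⬝ᵥ z) = 0 := by
    field_simp
    ring
  rw [this, zero_smul, sub_zero]

theorem mul_mixer_some_of_ne (M : Matrix (Option m) (Option m) ℝ) {w j : m} (hj : j ≠ w)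
    (a : Option m) : (M * mixer w) a (some j) = M a (some j) := by
  simp [mul_apply, Fintype.sum_option, mixer, hj]

theorem mul_mixer_some_self (M : Matrix (Option m) (Option m) ℝ) (w : m) (a : Option m) :
    (M * mixer w) a (some w) = (√2)⁻¹ * (M a (some w) + M a none) := by
  simp only [mul_apply, Fintype.sum_option, mixer, of_apply, Option.elim]
  rw [Finset.sum_eq_single w] <;> simp +contextual
  ring

theorem mul_mixer_none (M : Matrix (Option m) (Option m) ℝ) (w : m) (a : Option m) :
    (M * mixer w) a none = (√2)⁻¹ * (M a (some w) - M a none) := by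
  simp only [mul_apply, Fintype.sum_option, mixer, of_apply, Option.elim]
  rw [Finset.sum_eq_single w] <;> simp +contextual
  ring

theorem mixer_mul_eq (M : Matrix (Option m) (Option m) ℝ) (w : m) (a b : Option m) :
    (mixer w * M) a b = (Mᵀ * mixer w) b a := by
  rw [← transpose_apply (mixer w * M), transpose_mul, (mixer_isSymm w).eq]

theorem mixer_mul_self (w : m) : mixer w * mixer w = 1 := by
  have h := inv_sqrt_two_mul_self
  ext a b
  rcases b with _ | j
  · rw [mul_mixer_none]
    rcases a with _ | i
    · simp [mixer]
      linarith
    · by_cases hi : i = w <;> simp [mixer, hi]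
  · by_cases hj : j = w
    · subst hj
      rw [mul_mixer_some_self]
      rcases a with _ | i
      · simp [mixer]
      · by_cases hi : i = j
        · subst hi
          simp [mixer]
          linarith
        · simp [mixer, hi]
    · rw [mul_mixer_some_of_ne _ hj]
      rcases a with _ | i
      · simp [mixer, hj]
      · by_cases hi : i = j
        · subst hi
          simp [mixer, hj]
        · simp [mixer, hi]

/-- Conjugation of `M` by the involution `mixer w`. -/
noncomputable def mix (w : m) (M : Matrix (Option m) (Option m) ℝ) :
    Matrix (Option m) (Option m) ℝ :=
  mixer w * M * mixer w

theorem mix_mix (w : m) (M : Matrix (Option m) (Option m) ℝ) : mix w (mix w M) = M := by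
  rw [mix, mix, ← mul_assoc, ← mul_assoc, mixer_mul_self, one_mul, mul_assoc, mixer_mul_self,
    mul_one]

theorem mix_isSymm (w : m) {M : Matrix (Option m) (Option m) ℝ} (hM : M.IsSymm) :
    (mix w M).IsSymm := by
  rw [IsSymm, mix, transpose_mul, transpose_mul, hM.eq, (mixer_isSymm w).eq, mul_assoc]

variable (M : Matrix (Option m) (Option m) ℝ) {w i j : m}

theorem mix_some_some (hi : i ≠ w) (hj : j ≠ w) :
    mix w M (some i) (some j) = M (some i) (some j) := by
  rw [mix, mul_mixer_some_of_ne _ hj, mixer_mul_eq, mul_mixer_some_of_ne _ hi, transpose_apply]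

theorem mix_some_self (hi : i ≠ w) :
    mix w M (some i) (some w) = (√2)⁻¹ * (M (some i) (some w) + M (some i) none) := by
  rw [mix, mul_mixer_some_self]
  simp only [mixer_mul_eq, mul_mixer_some_of_ne _ hi, transpose_apply]

theorem mix_some_none (hi : i ≠ w) :
    mix w M (some i) none = (√2)⁻¹ * (M (some i) (some w) - M (some i) none) := by
  rw [mix, mul_mixer_none]
  simp only [mixer_mul_eq, mul_mixer_some_of_ne _ hi, transpose_apply]

theorem mix_self_none : mix w M (some w) none =
    (M (some w) (some w) - M (some w) none + M none (some w) - M none none) / 2 := by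
  rw [mix, mul_mixer_none]
  simp only [mixer_mul_eq, mul_mixer_some_self, transpose_apply]
  linear_combination (M (some w) (some w) - M (some w) none + M none (some w) - M none none) *
    inv_sqrt_two_mul_self

theorem mix_self_self : mix w M (some w) (some w) =
    (M (some w) (some w) + M (some w) none + M none (some w) + M none none) / 2 := by
  rw [mix, mul_mixer_some_self]
  simp only [mixer_mul_eq, mul_mixer_some_self, transpose_apply]
  linear_combination (M (some w) (some w) + M (some w) none + M none (some w) + M none none) *
    inv_sqrt_two_mul_self

theorem mix_none_none : mix w M none none =
    (M (some w) (some w) - M (some w) none - M none (some w) + M none none) / 2 := by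
  rw [mix, mul_mixer_none]
  simp only [mixer_mul_eq, mul_mixer_none, transpose_apply]
  linear_combination (M (some w) (some w) - M (some w) none - M none (some w) + M none none) *
    inv_sqrt_two_mul_self

end Reflections

section Tilt

variable {m : Type*}

/-- The vector with entries `ε * s i` at `some i` and `1` at `none`. -/
def tiltVector (ε : ℝ) (s : m → ℝ) : Option m → ℝ :=
  fun a => a.elim 1 fun i => ε * s i

variable [Fintype m]

theorem tiltVector_dotProduct_self (ε : ℝ) (s : m → ℝ) :
    tiltVector ε s ⬝ᵥ tiltVector ε s = 1 + ∑ i, (ε * s i) ^ 2 := by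
  simp [dotProduct, Fintype.sum_option, tiltVector, sq]

theorem one_add_sum_sq_pos (ε : ℝ) (s : m → ℝ) : 0 < 1 + ∑ i, (ε * s i) ^ 2 := by
  positivity

variable [DecidableEq m]

/-- The reflection along `tiltVector ε s`. -/
noncomputable def tilt (ε : ℝ) (s : m → ℝ) : Matrix (Option m) (Option m) ℝ :=
  reflectionMatrix (tiltVector ε s)

theorem tilt_mul_self (ε : ℝ) (s : m → ℝ) : tilt ε s * tilt ε s = 1 :=
  reflectionMatrix_mul_self
    (tiltVector_dotProduct_self ε s ▸ (one_add_sum_sq_pos ε s).ne')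

theorem tilt_isSymm (ε : ℝ) (s : m → ℝ) : (tilt ε s).IsSymm :=
  reflectionMatrix_isSymm _

theorem tilt_apply (ε : ℝ) (s : m → ℝ) (a b : Option m) :
    tilt ε s a b = (1 : Matrix (Option m) (Option m) ℝ) a b -
      2 / (1 + ∑ i, (ε * s i) ^ 2) * (tiltVector ε s a * tiltVector ε s b) := by
  rw [tilt, reflectionMatrix, tiltVector_dotProduct_self]
  rfl

theorem tilt_zero (s : m → ℝ) : tilt 0 s = bordered 1 (-1) := by
  ext a b
  rw [tilt_apply]
  cases a <;> cases b <;> simp [tiltVector, one_apply]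
  norm_num

theorem bordered_conj_tilt_zero (s : m → ℝ) (X : Matrix (Option m) (Option m) ℝ) (a b : Option m) :
    (tilt 0 s * X * tilt 0 s) a b =
      (a.elim (-1) fun _ => 1) * X a b * (b.elim (-1) fun _ => 1) := by
  have h : bordered (1 : Matrix m m ℝ) (-1) =
      diagonal fun a : Option m => a.elim (-1) fun _ => 1 := by
    ext a b
    cases a <;> cases b <;> simp [one_apply, diagonal_apply]
  rw [tilt_zero, h, mul_diagonal, diagonal_mul]

/-- The part of the conjugate of `bordered C ε⁻¹` by `tilt ε s` that is smooth at `ε = 0`. -/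
noncomputable def tiltedPart (ε : ℝ) (C : Matrix m m ℝ) (s : m → ℝ) :
    Matrix (Option m) (Option m) ℝ :=
  tilt ε s * bordered C 0 * tilt ε s + of fun a b =>
    a.elim (b.elim 0 fun j =>
        -2 * s j / (1 + ∑ i, (ε * s i) ^ 2) * (1 - 2 / (1 + ∑ i, (ε * s i) ^ 2)))
      fun i => b.elim
        (-2 * s i / (1 + ∑ i, (ε * s i) ^ 2) * (1 - 2 / (1 + ∑ i, (ε * s i) ^ 2)))
        fun j => 4 * ε * s i * s j / (1 + ∑ i, (ε * s i) ^ 2) ^ 2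

theorem tilt_conj_bordered {ε : ℝ} (hε : ε ≠ 0) (C : Matrix m m ℝ) (s : m → ℝ) :
    tilt ε s * bordered C ε⁻¹ * tilt ε s =
      tiltedPart ε C s + single none none (ε⁻¹ * (1 - 2 / (1 + ∑ i, (ε * s i) ^ 2)) ^ 2) := by
  have h : bordered C ε⁻¹ = bordered C 0 + single none none ε⁻¹ := by
    ext a b
    cases a <;> cases b <;> simp
  rw [h, mul_add, add_mul, tiltedPart, add_assoc]
  congr 1
  have hD := (one_add_sum_sq_pos ε s).ne'
  ext a b
  have h1 : (tilt ε s * (single none none ε⁻¹ : Matrix (Option m) (Option m) ℝ) * tilt ε s) a b =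
      tilt ε s a none * ε⁻¹ * tilt ε s none b := by
    rw [mul_apply, Fintype.sum_option]
    simp
  rw [h1, tilt_apply, tilt_apply]
  generalize 1 + ∑ i, (ε * s i) ^ 2 = D at *
  cases a <;> cases b <;> simp [tiltVector] <;> field_simp <;> ring

theorem tiltedPart_zero_some_some (C : Matrix m m ℝ) (s : m → ℝ) (i j : m) :
    tiltedPart 0 C s (some i) (some j) = C i j := by
  simp [tiltedPart, bordered_conj_tilt_zero]

theorem tiltedPart_zero_some_none (C : Matrix m m ℝ) (s : m → ℝ) (i : m) :
    tiltedPart 0 C s (some i) none = 2 * s i := by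
  simp [tiltedPart, bordered_conj_tilt_zero]
  ring

theorem contDiff_tilt_apply {E : Type*} [NormedAddCommGroup E] [NormedSpace ℝ E]
    {ε : E → ℝ} {s : E → m → ℝ} (hε : ContDiff ℝ 1 ε) (hs : ContDiff ℝ 1 s) (a b : Option m) :
    ContDiff ℝ 1 fun x => tilt (ε x) (s x) a b := by
  have hD : ∀ x, 1 + ∑ i, (ε x * s x i) ^ 2 ≠ 0 := fun x => (one_add_sum_sq_pos _ _).ne'
  simp only [tilt_apply]
  cases a <;> cases b <;> simp only [tiltVector, Option.elim] <;> fun_prop (disch := exact hD _)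

theorem contDiff_tiltedPart_apply {E : Type*} [NormedAddCommGroup E] [NormedSpace ℝ E]
    {ε : E → ℝ} {C : E → Matrix m m ℝ} {s : E → m → ℝ} (hε : ContDiff ℝ 1 ε)
    (hC : ∀ i j, ContDiff ℝ 1 fun x => C x i j) (hs : ContDiff ℝ 1 s) (a b : Option m) :
    ContDiff ℝ 1 fun x => tiltedPart (ε x) (C x) (s x) a b := by
  have hD : ∀ x, 1 + ∑ i, (ε x * s x i) ^ 2 ≠ 0 := fun x => (one_add_sum_sq_pos _ _).ne'
  have hD2 : ∀ x, (1 + ∑ i, (ε x * s x i) ^ 2) ^ 2 ≠ 0 := fun x => pow_ne_zero 2 (hD x)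
  have hR := fun a b => contDiff_tilt_apply hε hs a b
  have hN : ∀ a b, ContDiff ℝ 1 fun x => bordered (C x) 0 a b := by
    intro a b
    cases a <;> cases b <;> simp only [bordered_none_none, bordered_none_some, bordered_some_none,
      bordered_some_some] <;> fun_prop
  simp only [tiltedPart, Matrix.add_apply, mul_apply, of_apply]
  refine ContDiff.add (by fun_prop) ?_
  cases a <;> cases b <;> simp only [Option.elim] <;>
    fun_prop (disch := first | exact hD _ | exact hD2 _)

end Tilt

section Splitting

variable {m : Type*}

/-- `H` arises from `G` by splitting the vertex `w` into the adjacent vertices `some w`, which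
inherits the neighbors in `α`, and `none`, which inherits the neighbors in `β`. -/
structure IsSplitting (G : SimpleGraph m) (w : m) (α β : Set m) (H : SimpleGraph (Option m)) :
    Prop where
  union_eq : α ∪ β = G.neighborSet w
  disjoint : Disjoint α β
  adj_some_some : ∀ {i j}, i ≠ w → j ≠ w → (H.Adj (some i) (some j) ↔ G.Adj i j)
  adj_some_self : ∀ {i}, i ≠ w → (H.Adj (some i) (some w) ↔ i ∈ α)
  adj_some_none : ∀ {i}, i ≠ w → (H.Adj (some i) none ↔ i ∈ β)
  adj_self_none : H.Adj (some w) none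

open Classical in
/-- The sign attached to a vertex by the pair `α`, `β`. -/
noncomputable def splitSign (α β : Set m) (i : m) : ℝ :=
  if i ∈ α then 1 else if i ∈ β then -1 else 0

namespace IsSplitting

variable {G : SimpleGraph m} {w : m} {α β : Set m} {H : SimpleGraph (Option m)}

theorem adj_iff (hS : IsSplitting G w α β H) (i : m) : G.Adj i w ↔ i ∈ α ∨ i ∈ β := by
  rw [← Set.mem_union, hS.union_eq, SimpleGraph.mem_neighborSet, G.adj_comm]

theorem splitSign_of_mem_right (hS : IsSplitting G w α β H) {i : m} (hi : i ∈ β) :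
    splitSign α β i = -1 := by
  have : i ∉ α := fun h => Set.disjoint_left.1 hS.disjoint h hi
  simp [splitSign, this, hi]

variable [Fintype m] [DecidableEq m]

theorem inS_mix (hS : IsSplitting G w α β H) {M : Matrix (Option m) (Option m) ℝ} (hM : M.IsSymm)
    (hG : ∀ i j, i ≠ j → (M (some i) (some j) ≠ 0 ↔ G.Adj i j))
    (hsign : ∀ i, M (some i) none = splitSign α β i * M (some i) (some w))
    (hne : M (some w) (some w) - M none none ≠ 0) : InS H (mix w M) := by
  have hsymm := mix_isSymm w hM
  have h2 : (√2)⁻¹ ≠ 0 := by positivity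
  have hself : ∀ i, i ≠ w → (mix w M (some i) (some w) ≠ 0 ↔ H.Adj (some i) (some w)) := by
    intro i hi
    rw [mix_some_self M hi, hS.adj_some_self hi, hsign i, mul_ne_zero_iff, and_iff_right h2]
    have hMi := hG i w hi
    rw [hS.adj_iff] at hMi
    by_cases hα : i ∈ α
    · have := hMi.2 (Or.inl hα)
      simpa [splitSign, hα, ← two_mul] using this
    · by_cases hβ : i ∈ β
      · simp [hS.splitSign_of_mem_right hβ, hα]
      · have : M (some i) (some w) = 0 := by tauto
        simp [this, hα]
  have hnone : ∀ i, i ≠ w → (mix w M (some i) none ≠ 0 ↔ H.Adj (some i) none) := by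
    intro i hi
    rw [mix_some_none M hi, hS.adj_some_none hi, hsign i, mul_ne_zero_iff, and_iff_right h2]
    have hMi := hG i w hi
    rw [hS.adj_iff] at hMi
    by_cases hα : i ∈ α
    · have : i ∉ β := fun h => Set.disjoint_left.1 hS.disjoint hα h
      simp [splitSign, hα, this]
    · by_cases hβ : i ∈ β
      · have := hMi.2 (Or.inr hβ)
        simpa [hS.splitSign_of_mem_right hβ, hβ, ← two_mul] using this
      · have : M (some i) (some w) = 0 := by tauto
        simp [this, hβ]
  have hnew : mix w M (some w) none ≠ 0 ↔ H.Adj (some w) none := by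
    refine iff_of_true ?_ hS.adj_self_none
    rw [mix_self_none, hM.apply (some w) none, sub_add_cancel]
    exact div_ne_zero hne two_ne_zero
  have hnone' : ∀ i, mix w M (some i) none ≠ 0 ↔ H.Adj (some i) none := by
    intro i
    by_cases hi : i = w
    · exact hi ▸ hnew
    · exact hnone i hi
  refine ⟨hsymm, ?_⟩
  rintro (_ | i) (_ | j) hij
  · exact absurd rfl hij
  · rw [← hsymm.apply, H.adj_comm]
    exact hnone' j
  · exact hnone' i
  · have hij' : i ≠ j := fun h => hij (congrArg some h)
    by_cases hj : j = w
    · subst hj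
      exact hself i hij'
    · by_cases hi : i = w
      · subst hi
        rw [← hsymm.apply, H.adj_comm]
        exact hself j hj
      · rw [mix_some_some M hi hj, hS.adj_some_some hi hj]
        exact hG i j hij'

theorem eq_zero_of_mix (hS : IsSplitting G w α β H) {A : Matrix m m ℝ} (hA : InS G A)
    (hssp : HasSSP A) {X : Option m → Option m → ℝ} (hX : X ∈ nonedgeSpace H)
    (hz : ∀ i, mix w (of X) (some i) none = 0)
    (hc : A * (mix w (of X)).submatrix some some = (mix w (of X)).submatrix some some * A) :
    X = 0 := by
  have hXs : (of X).IsSymm := by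
    ext a b
    exact (hX b a).1
  have hYs := mix_isSymm w hXs
  have h2 : (√2)⁻¹ ≠ 0 := by positivity
  have hnew : X (some w) none = 0 := (hX _ _).2 (Or.inl hS.adj_self_none)
  have hnew' : X none (some w) = 0 := (hX _ _).1.trans hnew
  have hdiag : ∀ a, X a a = 0 := fun a => (hX a a).2 (Or.inr rfl)
  have hw : ∀ i, G.Adj i w → mix w (of X) (some i) (some w) = 0 := by
    intro i hi
    have hiw : i ≠ w := hi.ne
    have hzi := hz i
    rw [mix_some_none _ hiw, mul_eq_zero, or_iff_right h2, of_apply, of_apply] at hzi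
    rw [mix_some_self _ hiw, of_apply, of_apply]
    rcases (hS.adj_iff i).1 hi with h | h
    · have h0 : X (some i) (some w) = 0 := (hX _ _).2 (Or.inl ((hS.adj_some_self hiw).2 h))
      have h1 : X (some i) none = 0 := by linarith
      rw [h0, h1, add_zero, mul_zero]
    · have h0 : X (some i) none = 0 := (hX _ _).2 (Or.inl ((hS.adj_some_none hiw).2 h))
      have h1 : X (some i) (some w) = 0 := by linarith
      rw [h0, h1, add_zero, mul_zero]
  have hmem : (fun i j => mix w (of X) (some i) (some j)) ∈ nonedgeSpace G := by
    refine fun i j => ⟨hYs.apply _ _, ?_⟩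
    by_cases hj : j = w
    · subst hj
      rintro (h | rfl)
      · exact hw i h
      · simp [mix_self_self, hnew, hnew', hdiag]
    · by_cases hi : i = w
      · subst hi
        rintro (h | rfl)
        · exact (hYs.apply _ _).trans (hw j h.symm)
        · exact absurd rfl hj
      · change G.Adj i j ∨ i = j → mix w (of X) (some i) (some j) = 0
        rw [mix_some_some _ hi hj, of_apply]
        rintro (h | rfl)
        · exact (hX _ _).2 (Or.inl ((hS.adj_some_some hi hj).2 h))
        · exact hdiag _
  have hY11 := (hasSSP_iff hA).1 hssp _ hmem hc
  have hY : mix w (of X) = 0 := by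
    ext a b
    rcases a with _ | i <;> rcases b with _ | j
    · simp [mix_none_none, hnew, hnew', hdiag]
    · rw [← hYs.apply, hz]
      rfl
    · exact hz i
    · exact congrFun (congrFun hY11 i) j
  have := mix_mix w (of X)
  rw [hY, mix, mul_zero, zero_mul] at this
  exact this.symm

end IsSplitting

end Splitting

section CommutationDefect

variable {m : Type*} [Fintype m]

/-- The obstruction to `Z` commuting with `bordered C ε⁻¹`, rescaled to make sense at `ε = 0`. -/
def commDefect (ε : ℝ) (C : Matrix m m ℝ) (Z : Matrix (Option m) (Option m) ℝ) :
    (m → ℝ) × Matrix m m ℝ :=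
  (fun i => ε * ∑ j, C i j * Z (some j) none - Z (some i) none,
    C * Z.submatrix some some - Z.submatrix some some * C)

theorem commDefect_smul (ε : ℝ) (C : Matrix m m ℝ) (r : ℝ)
    (Z : Matrix (Option m) (Option m) ℝ) :
    commDefect ε C (r • Z) = r • commDefect ε C Z := by
  refine Prod.ext ?_ ?_
  · ext i
    simp only [commDefect, Matrix.smul_apply, smul_eq_mul, Prod.smul_fst, Pi.smul_apply, mul_sub,
      Finset.mul_sum]
    congr 1
    exact Finset.sum_congr rfl fun j _ => by ring
  · simp only [commDefect, submatrix_smul, Pi.smul_apply, Prod.smul_snd, Matrix.mul_smul,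
      Matrix.smul_mul, smul_sub]

theorem commDefect_eq_zero {ε : ℝ} (hε : ε ≠ 0) {C : Matrix m m ℝ}
    {Z : Matrix (Option m) (Option m) ℝ} (h : bordered C ε⁻¹ * Z = Z * bordered C ε⁻¹) :
    commDefect ε C Z = 0 := by
  refine Prod.ext ?_ ?_
  · ext i
    have := congrFun (congrFun h (some i)) none
    simp only [mul_apply, Fintype.sum_option, bordered_some_none, bordered_some_some,
      bordered_none_none, zero_mul, zero_add, mul_zero, Finset.sum_const_zero, add_zero] at this
    simp only [commDefect, this]
    simp [mul_comm (Z _ _), hε]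
  · refine sub_eq_zero.2 ?_
    ext i j
    have := congrFun (congrFun h (some i)) (some j)
    simpa [mul_apply, Fintype.sum_option] using this

theorem commute_conj_of_commute {R : Type*} [Ring R] {P Q N X : R} (hPQ : P * Q = 1)
    (h : Q * N * P * X = X * (Q * N * P)) : N * (P * X * Q) = P * X * Q * N := by
  calc N * (P * X * Q) = P * Q * N * (P * X * Q) := by rw [hPQ, one_mul]
    _ = P * (Q * N * P * X) * Q := by simp only [mul_assoc]
    _ = P * (X * (Q * N * P)) * Q := by rw [h]
    _ = P * X * Q * N * (P * Q) := by simp only [mul_assoc]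
    _ = P * X * Q * N := by rw [hPQ, mul_one]

end CommutationDefect

section Deformation

variable {m : Type*} [Fintype m] [DecidableEq m] {G : SimpleGraph m} {w : m} {α β : Set m}
  {H : SimpleGraph (Option m)}

open Filter Topology in
theorem IsSplitting.eventually_exists (hS : IsSplitting G w α β H) {A : Matrix m m ℝ}
    (hA : InS G A) (hssp : HasSSP A) :
    ∀ᶠ ε in 𝓝 (0 : ℝ), ε ≠ 0 → ∃ A' : Matrix (Option m) (Option m) ℝ,
      InS H A' ∧ HasSSP A' ∧ ∀ t, multOf A' t = multOf A t + if t = ε⁻¹ then 1 else 0 := by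
  let K := nonedgeCommutator G A
  let σ := splitSign α β
  let C : ℝ × nonedgeSpace G × (m → ℝ) → Matrix m m ℝ := fun p => expConj A (K p.2.1)
  let B : ℝ × nonedgeSpace G × (m → ℝ) → Matrix (Option m) (Option m) ℝ := fun p =>
    tiltedPart p.1 (C p) p.2.2
  let proj : (m → m → ℝ) →L[ℝ] nonedgeSpace G :=
    (nonedgeProj G ∘ₗ (ofLinearEquiv ℝ).toLinearMap).toContinuousLinearMap
  let F : ℝ × nonedgeSpace G × (m → ℝ) → nonedgeSpace G × (m → ℝ) := fun p =>
    (proj fun i j => B p (some i) (some j),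
      fun i => B p (some i) none - σ i * B p (some i) (some w))
  let s₀ : m → ℝ := fun i => σ i * A i w / 2
  let e₀ : nonedgeSpace G × (m → ℝ) := (0, s₀)
  let L : nonedgeSpace G × (m → ℝ) → nonedgeSpace G × (m → ℝ) := fun v =>
    (proj fun i j => (A * K v.1 - K v.1 * A) i j,
      fun i => 2 * v.2 i - σ i * (A * K v.1 - K v.1 * A) i w)
  have hC : ∀ i j, ContDiff ℝ 1 fun p => C p i j := fun i j =>
    (contDiff_expConj_apply A K i j).comp (contDiff_fst.comp contDiff_snd)
  have hs : ContDiff ℝ 1 fun p : ℝ × nonedgeSpace G × (m → ℝ) => p.2.2 :=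
    contDiff_snd.comp contDiff_snd
  have hB : ∀ a b, ContDiff ℝ 1 fun p => B p a b := contDiff_tiltedPart_apply contDiff_fst hC hs
  have hF : ContDiff ℝ 1 F := by
    refine ContDiff.prodMk ?_ ?_
    · exact proj.contDiff.comp (contDiff_pi.2 fun i => contDiff_pi.2 fun j => hB _ _)
    · exact contDiff_pi.2 fun i => (hB _ _).sub (contDiff_const.mul (hB _ _))
  have hFline : ∀ v (t : ℝ), F (0, e₀ + t • v) = (proj fun i j => expConj A (t • K v.1) i j,
      fun i => 2 * (s₀ i + t * v.2 i) - σ i * expConj A (t • K v.1) i w) := by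
    intro v t
    simp only [F, B, C, e₀, tiltedPart_zero_some_some, tiltedPart_zero_some_none, Prod.fst_add,
      Prod.snd_add, Prod.smul_fst, Prod.smul_snd, zero_add, map_smul, Pi.add_apply, Pi.smul_apply,
      smul_eq_mul]
  have hF₀ : F (0, e₀) = 0 := by
    have hproj : (proj fun i j => A i j) = 0 := by
      ext i j
      by_cases h : G.Adj i j ∨ i = j
      · exact ((proj fun i j => A i j).2 i j).2 h
      · push Not at h
        have hij : A i j = 0 := not_not.1 (mt (hA.2 i j h.2).1 h.1)
        have := nonedgeProj_apply_of_not_adj A h.2 h.1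
        rw [hA.1.apply i j, hij, add_zero] at this
        exact this
    have := hFline 0 0
    rw [smul_zero, add_zero] at this
    rw [this]
    refine Prod.ext ?_ ?_
    · simpa [expConj_zero] using hproj
    · ext i
      simp [expConj_zero, s₀]
      ring
  have hL : ∀ v, HasDerivAt (fun t : ℝ => F (0, e₀ + t • v)) (L v) 0 := by
    intro v
    have hE := hasDerivAt_expConj_apply A (K v.1)
    simp only [hFline]
    refine HasDerivAt.prodMk ?_ ?_
    · exact proj.hasFDerivAt.comp_hasDerivAt (0 : ℝ)
        (hasDerivAt_pi.2 fun i => hasDerivAt_pi.2 fun j => hE i j)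
    · refine hasDerivAt_pi.2 fun i => ?_
      have h1 : HasDerivAt (fun t : ℝ => 2 * (s₀ i + t * v.2 i)) (2 * v.2 i) 0 := by
        simpa using (((hasDerivAt_id (0 : ℝ)).mul_const (v.2 i)).const_add (s₀ i)).const_mul 2
      exact h1.sub ((hE i w).const_mul (σ i))
  have hsurj : Function.Surjective L := by
    rintro ⟨y, r⟩
    obtain ⟨X, hX⟩ := nonedgeProj_commutator_surjective hA hssp y
    refine ⟨(X, fun i => (r i + σ i * (A * K X - K X * A) i w) / 2), Prod.ext hX ?_⟩
    ext i
    simp only [L]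
    ring
  have hP₁ : ∀ᶠ p in 𝓝 (0, e₀), ∀ i j, G.Adj i j → B p (some i) (some j) ≠ 0 := by
    refine eventually_all.2 fun i => eventually_all.2 fun j => ?_
    by_cases h : G.Adj i j
    · have : B (0, e₀) (some i) (some j) ≠ 0 := by
        simp only [B, C, e₀, tiltedPart_zero_some_some, map_zero, expConj_zero]
        exact (hA.2 i j h.ne).2 h
      filter_upwards [(hB (some i) (some j)).continuous.continuousAt.eventually_ne this] with p hp
        using fun _ => hp
    · exact Eventually.of_forall fun p h' => absurd h' h
  let ρ : ℝ × nonedgeSpace G × (m → ℝ) → ℝ := fun p => 1 - 2 / (1 + ∑ i, (p.1 * p.2.2 i) ^ 2)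
  have hP₂ : ∀ᶠ p in 𝓝 (0, e₀),
      p.1 * (B p (some w) (some w) - B p none none) - ρ p ^ 2 ≠ 0 := by
    have hρ : Continuous ρ := by
      have hD : ∀ p : ℝ × nonedgeSpace G × (m → ℝ), 1 + ∑ i, (p.1 * p.2.2 i) ^ 2 ≠ 0 :=
        fun p => (one_add_sum_sq_pos p.1 p.2.2).ne'
      fun_prop (disch := exact hD)
    have hcont : Continuous fun p => p.1 * (B p (some w) (some w) - B p none none) - ρ p ^ 2 := by
      have h1 := (hB (some w) (some w)).continuous
      have h2 := (hB none none).continuous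
      fun_prop
    refine hcont.continuousAt.eventually_ne ?_
    simp only [ρ]
    norm_num
  let Z : ℝ × nonedgeSpace G × (m → ℝ) → (Option m → Option m → ℝ) →
      Matrix (Option m) (Option m) ℝ := fun p X => tilt p.1 p.2.2 * mix w (of X) * tilt p.1 p.2.2
  have hP₃ : ∀ᶠ p in 𝓝 (0, e₀), ∀ X ∈ nonedgeSpace H, commDefect p.1 (C p) (Z p X) = 0 → X = 0 := by
    refine eventually_kernel_trivial (nonedgeSpace H) ?_ ?_ ?_
    · have hT : Continuous fun q : (ℝ × nonedgeSpace G × (m → ℝ)) × (Option m → Option m → ℝ) =>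
          tilt q.1.1 q.1.2.2 := continuous_matrix fun a b =>
        (contDiff_tilt_apply contDiff_fst hs a b).continuous.comp continuous_fst
      have hX : Continuous fun q : (ℝ × nonedgeSpace G × (m → ℝ)) × (Option m → Option m → ℝ) =>
          mix w (of q.2) :=
        (continuous_const.matrix_mul continuous_snd).matrix_mul continuous_const
      have hZ : Continuous fun q : (ℝ × nonedgeSpace G × (m → ℝ)) × (Option m → Option m → ℝ) =>
          Z q.1 q.2 := (hT.matrix_mul hX).matrix_mul hT
      have hC' : Continuous fun q : (ℝ × nonedgeSpace G × (m → ℝ)) × (Option m → Option m → ℝ) =>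
          C q.1 := continuous_matrix fun a b => (hC a b).continuous.comp continuous_fst
      have hZ' := hZ.matrix_submatrix (some : m → Option m) (some : m → Option m)
      refine Continuous.prodMk (continuous_pi fun i => ?_)
        ((hC'.matrix_mul hZ').sub (hZ'.matrix_mul hC'))
      refine Continuous.sub ((continuous_fst.comp continuous_fst).mul
        (continuous_finsetSum _ fun j _ => ?_)) (hZ.matrix_elem _ _)
      exact (hC'.matrix_elem _ _).mul (hZ.matrix_elem _ _)
    · intro p r X
      have : Z p (r • X) = r • Z p X := by
        simp only [Z, mix, ← smul_of, Matrix.mul_smul, Matrix.smul_mul]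
      rw [this, commDefect_smul]
    · intro X hX h0
      have hC₀ : C (0, e₀) = A := by simp only [C, e₀, map_zero, expConj_zero]
      have hZ₀ : ∀ i b, Z (0, e₀) X (some i) b =
          mix w (of X) (some i) b * b.elim (-1) fun _ => 1 := by
        intro i b
        simp only [Z, bordered_conj_tilt_zero, Option.elim, one_mul]
      rw [hC₀] at h0
      refine hS.eq_zero_of_mix hA hssp hX (fun i => ?_) ?_
      · have := congrFun (congrArg Prod.fst h0) i
        simpa [commDefect, hZ₀] using this
      · have hsub : (Z (0, e₀) X).submatrix some some = (mix w (of X)).submatrix some some := by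
          ext i j
          simp [hZ₀]
        have := sub_eq_zero.1 (congrArg Prod.snd h0)
        rwa [hsub] at this
  filter_upwards [eventually_exists_zero_of_surjective_partial hF hF₀ hL hsurj
    (hP₁.and (hP₂.and hP₃))] with ε hε hε0
  obtain ⟨⟨X, s⟩, hFz, hB₁, hB₂, hker⟩ := hε
  set p : ℝ × nonedgeSpace G × (m → ℝ) := (ε, X, s) with hp
  have hκ : (K X)ᵀ = -K X := nonedgeCommutator_transpose hA.1 X
  have hCs : (C p).IsSymm := expConj_isSymm hA.1 hκ
  set R := tilt ε s with hR
  set M := R * bordered (C p) ε⁻¹ * R with hM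
  have hMB : M = B p + single none none (ε⁻¹ * ρ p ^ 2) := tilt_conj_bordered hε0 _ _
  have hMs : M.IsSymm := by
    rw [hM, IsSymm, transpose_mul, transpose_mul, (bordered_isSymm hCs _).eq, (tilt_isSymm _ _).eq,
      mul_assoc]
  have hM₁ : ∀ i b, M (some i) b = B p (some i) b := by
    intro i b
    simp [hMB]
  have hF₁ : ∀ i j, i ≠ j → ¬ G.Adj i j → M (some i) (some j) = 0 := by
    intro i j hij h
    have h1 := nonedgeProj_apply_of_not_adj (of fun i j => B p (some i) (some j)) hij h
    have h2 : nonedgeProj G (of fun i j => B p (some i) (some j)) = 0 := congrArg Prod.fst hFz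
    rw [h2, of_apply, of_apply, ← hM₁, ← hM₁, hMs.apply (some i)] at h1
    have h3 : (0 : ℝ) = M (some i) (some j) + M (some i) (some j) := h1
    linarith
  have hInS : InS H (mix w M) := by
    refine hS.inS_mix hMs (fun i j hij => ⟨fun h => ?_, fun h => ?_⟩) (fun i => ?_) ?_
    · by_contra h'
      exact h (hF₁ i j hij h')
    · rw [hM₁]
      exact hB₁ i j h
    · have := congrFun (congrArg Prod.snd hFz) i
      rw [hM₁, hM₁]
      exact sub_eq_zero.1 this
    · intro h
      apply hB₂
      have h' : B p (some w) (some w) - (B p none none + ε⁻¹ * ρ p ^ 2) = 0 := by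
        simpa [hMB] using h
      calc ε * (B p (some w) (some w) - B p none none) - ρ p ^ 2
          = ε * (B p (some w) (some w) - (B p none none + ε⁻¹ * ρ p ^ 2)) := by field_simp; ring
        _ = 0 := by rw [h', mul_zero]
  have hPQ : R * mixer w * (mixer w * R) = 1 := by
    rw [mul_assoc, ← mul_assoc (mixer w), mixer_mul_self, one_mul, tilt_mul_self]
  have hQP : mixer w * R * (R * mixer w) = 1 := by
    rw [mul_assoc, ← mul_assoc R, tilt_mul_self, one_mul, mixer_mul_self]
  have hmix : mix w M = mixer w * R * bordered (C p) ε⁻¹ * (R * mixer w) := by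
    simp only [mix, hM, mul_assoc]
  refine ⟨mix w M, hInS, (hasSSP_iff hInS).2 fun Y hY hc => hker Y hY ?_, fun t => ?_⟩
  · refine commDefect_eq_zero hε0 ?_
    rw [hmix] at hc
    have := commute_conj_of_commute hPQ hc
    simpa only [Z, mix, mul_assoc] using this
  · rw [hmix, multOf_conj hQP, multOf_bordered]
    congr 1
    exact multOf_conj (exp_neg_mul_exp _) A t

end Deformation

section Reindexing

variable {l m : Type*} [Fintype l] [DecidableEq l] [Fintype m] [DecidableEq m]

theorem InS.submatrix_equiv {H : SimpleGraph m} {A : Matrix m m ℝ} (hA : InS H A) (e : l ≃ m) :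
    InS (H.comap e) (A.submatrix e e) :=
  ⟨hA.1.submatrix e, fun i j hij => hA.2 (e i) (e j) (e.injective.ne hij)⟩

theorem HasSSP.submatrix_equiv {A : Matrix m m ℝ} (hA : HasSSP A) (e : l ≃ m) :
    HasSSP (A.submatrix e e) := by
  intro X hX hAX hIX hc
  have hX0 : X.submatrix e.symm e.symm = 0 := by
    refine hA _ (hX.submatrix e.symm) ?_ ?_ ?_
    · ext i j
      simpa using congrFun (congrFun hAX (e.symm i)) (e.symm j)
    · ext i j
      simpa [one_apply] using congrFun (congrFun hIX (e.symm i)) (e.symm j)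
    · have h := congrArg (fun M => M.submatrix e.symm e.symm) hc
      simpa only [submatrix_sub, Pi.sub_apply, ← submatrix_mul_equiv _ _ e.symm e.symm e.symm,
        submatrix_submatrix, Equiv.self_comp_symm, submatrix_id_id, submatrix_zero,
        Pi.zero_apply] using h
  ext i j
  simpa using congrFun (congrFun hX0 (e i)) (e j)

end Reindexing

theorem isSplitting_decontract {n : ℕ} {G : SimpleGraph (Fin (n + 1))} {α β : Set (Fin (n + 1))}
    (hpart : α ∪ β = G.neighborSet (Fin.last n)) (hdisj : Disjoint α β) :
    IsSplitting G (Fin.last n) α β ((decontract G α β).comap finSuccEquivLast.symm) where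
  union_eq := hpart
  disjoint := hdisj
  adj_some_some {i j} hi hj := by
    have := G.ne_of_adj (a := i) (b := j)
    simp [decontract, hi, hj, G.adj_comm j i]
    tauto
  adj_some_self {i} hi := by
    simp [decontract, hi]
  adj_some_none {i} hi := by
    simp [decontract, hi, (Fin.castSucc_ne_last _).symm]
  adj_self_none := by
    simp [decontract]

/-- Decontraction Lemma for the SSP: if `A ∈ S(G)` has the SSP and
`N_G(n) = α ⊔ β`, then for all sufficiently large `λ` there is an SSP matrix
`A' ∈ S(H)` whose spectrum is that of `A` together with the additional simple
eigenvalue `λ`, where `H` is the decontraction of `G` along the partition. -/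
theorem decontraction_SSP {n : ℕ} (G : SimpleGraph (Fin (n + 1)))
    (A : Matrix (Fin (n + 1)) (Fin (n + 1)) ℝ) (hA : InS G A) (hssp : HasSSP A)
    (α β : Set (Fin (n + 1)))
    (hpart : α ∪ β = G.neighborSet (Fin.last n)) (hdisj : Disjoint α β) :
    ∃ lam₀ : ℝ, ∀ lam : ℝ, lam₀ ≤ lam →
      ∃ A' : Matrix (Fin (n + 2)) (Fin (n + 2)) ℝ,
        InS (decontract G α β) A' ∧ HasSSP A' ∧
        multOf A' lam = 1 ∧
        ∀ t : ℝ, multOf A' t = multOf A t + (if t = lam then 1 else 0) := by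
  have hlam := (tendsto_inv_atTop_zero (𝕜 := ℝ)).eventually
    ((isSplitting_decontract hpart hdisj).eventually_exists hA hssp)
  obtain ⟨lam₀, h⟩ := Filter.eventually_atTop.1
    (hlam.and ((eventually_multOf_eq_zero A).and (Filter.eventually_gt_atTop 0)))
  refine ⟨lam₀, fun lam hle => ?_⟩
  obtain ⟨hex, hmult, hpos⟩ := h lam hle
  obtain ⟨A', hA', hssp', hspec⟩ := hex (inv_ne_zero hpos.ne')
  rw [inv_inv] at hspec
  have hspec' : ∀ t, multOf (A'.submatrix finSuccEquivLast finSuccEquivLast) t =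
      multOf A t + if t = lam then 1 else 0 := fun t => by
    rw [multOf_submatrix_equiv, hspec]
  refine ⟨A'.submatrix finSuccEquivLast finSuccEquivLast, ?_, hssp'.submatrix_equiv _, ?_, hspec'⟩
  · have := hA'.submatrix_equiv (finSuccEquivLast (n := n + 1))
    rwa [SimpleGraph.comap_comap, Equiv.symm_comp_self, SimpleGraph.comap_id] at this
  · rw [hspec', hmult, if_pos rfl]
end
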